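/- Data processing inequality for relaxed Wyner's common information: if X, Y, Z are random variables on finite alphabets forming a Markov chain X — Y — Z (i.e., X and Z are conditionally independent given Y), then for every γ ≥ 0, C_γ(X;Z) ≤ min{ C_γ(X;Y), C_γ(Y;Z) }. -/

import Mathlib

open scoped BigOperators
open Classical

noncomputable section

/-- `p` is a probability mass function on the finite alphabet `α`. -/
def IsPMF {α : Type*} [Fintype α] (p : α → ℝ) : Prop :=
  (∀ a, 0 ≤ p a) ∧ ∑ a, p a = 1

/-- Pushforward of a pmf under a map (distribution of `f(X)` when `X ~ p`). -/
noncomputable def pmfMap {α β : Type*} [Fintype α] (f : α → β) (p : α → ℝ) : β → ℝ :=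
  fun b => ∑ a, if f a = b then p a else 0

/-- Shannon entropy (in nats) of a pmf on a finite alphabet. -/
noncomputable def Hent {α : Type*} [Fintype α] (p : α → ℝ) : ℝ :=
  ∑ a, Real.negMulLog (p a)

/-- Mutual information `I(X;Y)` of a joint pmf `p` of the pair `(X,Y)`. -/
noncomputable def mi {α β : Type*} [Fintype α] [Fintype β] (p : α × β → ℝ) : ℝ :=
  Hent (pmfMap Prod.fst p) + Hent (pmfMap Prod.snd p) - Hent p

/-- Mutual information `I(X,Y;W)` of a joint pmf `q` of the triple `((X,Y),W)`. -/
noncomputable def miW {α β W : Type*} [Fintype α] [Fintype β] [Fintype W]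
    (q : (α × β) × W → ℝ) : ℝ :=
  Hent (pmfMap Prod.fst q) + Hent (pmfMap Prod.snd q) - Hent q

/-- Conditional mutual information `I(X;Y|W)` of a joint pmf `q` of `((X,Y),W)`,
written as `H(X,W) + H(Y,W) - H(W) - H(X,Y,W)`. -/
noncomputable def cmi {α β W : Type*} [Fintype α] [Fintype β] [Fintype W]
    (q : (α × β) × W → ℝ) : ℝ :=
  Hent (pmfMap (fun x => (x.1.1, x.2)) q) + Hent (pmfMap (fun x => (x.1.2, x.2)) q)
    - Hent (pmfMap Prod.snd q) - Hent q

/-- The set of values `I(X,Y;W)` over all finite-alphabet `W` jointly distributed with `(X,Y)`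
(i.e. over all conditional distributions `p(w|x,y)`) such that `I(X;Y|W) ≤ γ`. -/
def relaxedSet {α β : Type*} [Fintype α] [Fintype β] (p : α × β → ℝ) (γ : ℝ) : Set ℝ :=
  { c | ∃ (m : ℕ) (q : (α × β) × Fin m → ℝ), IsPMF q ∧
      (pmfMap Prod.fst q = p) ∧ cmi q ≤ γ ∧ c = miW q }

/-- Relaxed Wyner's common information `C_γ(X;Y)` of a joint pmf `p` of `(X,Y)`. -/
noncomputable def Cgamma {α β : Type*} [Fintype α] [Fintype β] (p : α × β → ℝ) (γ : ℝ) : ℝ :=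
  sInf (relaxedSet p γ)

/-- Wyner's common information `C(X;Y)`: infimum of `I(X,Y;W)` over all finite-alphabet `W`
rendering `X` and `Y` conditionally independent, i.e. `I(X;Y|W) = 0`. -/
noncomputable def WynerCI {α β : Type*} [Fintype α] [Fintype β] (p : α × β → ℝ) : ℝ :=
  sInf { c | ∃ (m : ℕ) (q : (α × β) × Fin m → ℝ), IsPMF q ∧
      (pmfMap Prod.fst q = p) ∧ cmi q = 0 ∧ c = miW q }

end

theorem sum_ite_zero_of_decidable {ι : Type*} [Fintype ι] (P : Prop) (f : ι → ℝ)
    {inst : ι → Decidable P} :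
    (∑ x, @ite ℝ P (inst x) (f x) 0) = @ite ℝ P (propDecidable P) (∑ x, f x) 0 := by
  by_cases h : P <;> simp [h]

theorem pmfMap_id {α : Type*} [Fintype α] (p : α → ℝ) : pmfMap (fun x => x) p = p := by
  funext x
  simp [pmfMap]

theorem pmfMap_pmfMap {α β δ : Type*} [Fintype α] [Fintype β] (f : α → β) (g : β → δ)
    (p : α → ℝ) : pmfMap g (pmfMap f p) = pmfMap (fun a => g (f a)) p := by
  funext c
  simp only [pmfMap]
  calc (∑ b, if g b = c then ∑ a, (if f a = b then p a else 0) else 0)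
      = ∑ b, ∑ a, if f a = b then (if g b = c then p a else 0) else 0 := by
        refine Finset.sum_congr rfl fun b _ => ?_
        split_ifs <;> simp
    _ = ∑ a, if g (f a) = c then p a else 0 := by
        rw [Finset.sum_comm]
        simp

theorem pmfMap_apply_of_injective {α β : Type*} [Fintype α] {f : α → β}
    (hf : Function.Injective f) (p : α → ℝ) (a : α) : pmfMap f p (f a) = p a := by
  simp [pmfMap, hf.eq_iff]

theorem pmfMap_nonneg {α β : Type*} [Fintype α] (f : α → β) {p : α → ℝ}
    (hp : ∀ a, 0 ≤ p a) (b : β) : 0 ≤ pmfMap f p b :=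
  Finset.sum_nonneg fun a _ => by split_ifs <;> simp [hp a]

theorem le_pmfMap_apply {α β : Type*} [Fintype α] (f : α → β) {p : α → ℝ}
    (hp : ∀ a, 0 ≤ p a) (a : α) : p a ≤ pmfMap f p (f a) := by
  have := Finset.single_le_sum (f := fun x => if f x = f a then p x else 0)
    (fun x _ => by split_ifs <;> simp [hp x]) (Finset.mem_univ a)
  simpa [pmfMap] using this

theorem sum_pmfMap_mul {α β : Type*} [Fintype α] [Fintype β] (f : α → β) (p : α → ℝ)
    (F : β → ℝ) : ∑ b, pmfMap f p b * F b = ∑ a, p a * F (f a) := by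
  simp only [pmfMap, Finset.sum_mul, ite_mul, zero_mul]
  rw [Finset.sum_comm]
  simp

theorem sum_pmfMap {α β : Type*} [Fintype α] [Fintype β] (f : α → β) (p : α → ℝ) :
    ∑ b, pmfMap f p b = ∑ a, p a := by
  simpa using sum_pmfMap_mul f p fun _ => 1

theorem IsPMF.pmfMap {α β : Type*} [Fintype α] [Fintype β] {p : α → ℝ} (hp : IsPMF p)
    (f : α → β) : IsPMF (pmfMap f p) :=
  ⟨pmfMap_nonneg f hp.1, by rw [sum_pmfMap, hp.2]⟩

theorem Hent_pmfMap {α β : Type*} [Fintype α] [Fintype β] (f : α → β) (p : α → ℝ) :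
    Hent (pmfMap f p) = -∑ a, p a * Real.log (pmfMap f p (f a)) := by
  rw [← sum_pmfMap_mul f p fun b => Real.log (pmfMap f p b), Hent, ← Finset.sum_neg_distrib]
  simp [Real.negMulLog]

/-- The entropy of `f(X)` depends only on the partition induced by `f`. -/
theorem Hent_pmfMap_congr {α β δ : Type*} [Fintype α] [Fintype β] [Fintype δ] (p : α → ℝ)
    (f : α → β) (g : α → δ) (h : ∀ x y, f x = f y ↔ g x = g y) :
    Hent (pmfMap f p) = Hent (pmfMap g p) := by
  simp only [Hent_pmfMap, pmfMap, h]

theorem cmi_eq_sum {α β W : Type*} [Fintype α] [Fintype β] [Fintype W]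
    (t : (α × β) × W → ℝ) :
    cmi t = ∑ x, t x * (Real.log (t x) + Real.log (pmfMap Prod.snd t x.2)
      - Real.log (pmfMap (fun x => (x.1.1, x.2)) t (x.1.1, x.2))
      - Real.log (pmfMap (fun x => (x.1.2, x.2)) t (x.1.2, x.2))) := by
  rw [cmi, Hent_pmfMap, Hent_pmfMap, Hent_pmfMap, Hent]
  simp only [mul_sub, mul_add, Finset.sum_sub_distrib, Finset.sum_add_distrib, Real.negMulLog,
    neg_mul, Finset.sum_neg_distrib]
  ring

theorem pmfMap_fst_fst_apply {α β W : Type*} [Fintype α] [Fintype β] [Fintype W]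
    (t : (α × β) × W → ℝ) (a : α) (w : W) :
    pmfMap (fun x => (x.1.1, x.2)) t (a, w) = ∑ b, t ((a, b), w) := by
  simp [pmfMap, Fintype.sum_prod_type, ite_and, sum_ite_zero_of_decidable]

theorem pmfMap_fst_snd_apply {α β W : Type*} [Fintype α] [Fintype β] [Fintype W]
    (t : (α × β) × W → ℝ) (b : β) (w : W) :
    pmfMap (fun x => (x.1.2, x.2)) t (b, w) = ∑ a, t ((a, b), w) := by
  simp [pmfMap, Fintype.sum_prod_type, ite_and]

theorem pmfMap_snd_apply {α W : Type*} [Fintype α] [Fintype W]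
    (t : α × W → ℝ) (w : W) : pmfMap Prod.snd t w = ∑ a, t (a, w) := by
  simp [pmfMap, Fintype.sum_prod_type]

theorem pmfMap_fst_apply {α W : Type*} [Fintype α] [Fintype W]
    (t : α × W → ℝ) (a : α) : pmfMap Prod.fst t a = ∑ w, t (a, w) := by
  simp [pmfMap, Fintype.sum_prod_type, sum_ite_zero_of_decidable]

theorem sub_le_mul_log {t d m n : ℝ} (ht : 0 ≤ t) (hd : t ≤ d) (hm : t ≤ m) (hn : t ≤ n) :
    t - m * n / d ≤ t * (Real.log t + Real.log d - Real.log m - Real.log n) := by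
  rcases ht.eq_or_lt with rfl | ht
  · have : 0 ≤ m * n / d := by positivity
    simpa using this
  · have hd' := ht.trans_le hd
    have hm' := ht.trans_le hm
    have hn' := ht.trans_le hn
    have key := Real.log_le_sub_one_of_pos (x := m * n / (t * d)) (by positivity)
    rw [Real.log_div (by positivity) (by positivity), Real.log_mul hm'.ne' hn'.ne',
      Real.log_mul ht.ne' hd'.ne'] at key
    have h := mul_le_mul_of_nonneg_left key ht.le
    have e : t * (m * n / (t * d) - 1) = m * n / d - t := by field_simp
    rw [e] at h
    linarith

/-- Conditional mutual information is nonnegative. -/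
theorem cmi_nonneg {α β W : Type*} [Fintype α] [Fintype β] [Fintype W]
    {t : (α × β) × W → ℝ} (ht : ∀ x, 0 ≤ t x) : 0 ≤ cmi t := by
  rw [cmi_eq_sum]
  set A := pmfMap (fun x : (α × β) × W => (x.1.1, x.2)) t with hA
  set B := pmfMap (fun x : (α × β) × W => (x.1.2, x.2)) t with hB
  set D := pmfMap (Prod.snd : (α × β) × W → W) t with hD
  have hle : ∑ x : (α × β) × W, (t x - A (x.1.1, x.2) * B (x.1.2, x.2) / D x.2) ≤
      ∑ x, t x * (Real.log (t x) + Real.log (D x.2) - Real.log (A (x.1.1, x.2))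
        - Real.log (B (x.1.2, x.2))) :=
    Finset.sum_le_sum fun x _ => sub_le_mul_log (ht x)
      (le_pmfMap_apply Prod.snd ht x)
      (le_pmfMap_apply (fun x : (α × β) × W => (x.1.1, x.2)) ht x)
      (le_pmfMap_apply (fun x : (α × β) × W => (x.1.2, x.2)) ht x)
  have hAD : ∀ w, ∑ a, A (a, w) = D w := fun w => by
    rw [← pmfMap_snd_apply A w, hA, hD, pmfMap_pmfMap]
  have hBD : ∀ w, ∑ b, B (b, w) = D w := fun w => by
    rw [← pmfMap_snd_apply B w, hB, hD, pmfMap_pmfMap]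
  have hsum : ∑ x : (α × β) × W, A (x.1.1, x.2) * B (x.1.2, x.2) / D x.2 = ∑ x, t x := by
    rw [← sum_pmfMap Prod.snd t, ← hD, Fintype.sum_prod_type_right]
    refine Finset.sum_congr rfl fun w _ => ?_
    dsimp only
    rw [← Finset.sum_div, Fintype.sum_prod_type]
    dsimp only
    rw [← Finset.sum_mul_sum, hAD, hBD, mul_self_div_self]
  rw [Finset.sum_sub_distrib, hsum, sub_self] at hle
  exact hle

/-- Conditional mutual information vanishes when the joint pmf factorizes given `W`. -/
theorem cmi_eq_zero_of_factor {α β W : Type*} [Fintype α] [Fintype β] [Fintype W]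
    {t : (α × β) × W → ℝ} (ht : ∀ x, 0 ≤ t x) (u : α → W → ℝ) (v : β → W → ℝ)
    (h : ∀ a b w, t ((a, b), w) = u a w * v b w) : cmi t = 0 := by
  rw [cmi_eq_sum]
  refine Finset.sum_eq_zero fun x _ => ?_
  rcases (ht x).eq_or_lt with h0 | h0
  · rw [← h0, zero_mul]
  have hd := h0.trans_le (le_pmfMap_apply Prod.snd ht x)
  have hm := h0.trans_le (le_pmfMap_apply (fun x : (α × β) × W => (x.1.1, x.2)) ht x)
  have hn := h0.trans_le (le_pmfMap_apply (fun x : (α × β) × W => (x.1.2, x.2)) ht x)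
  have key : t x * pmfMap Prod.snd t x.2 =
      pmfMap (fun x => (x.1.1, x.2)) t (x.1.1, x.2) *
        pmfMap (fun x => (x.1.2, x.2)) t (x.1.2, x.2) := by
    obtain ⟨⟨a, b⟩, w⟩ := x
    rw [pmfMap_snd_apply, pmfMap_fst_fst_apply, pmfMap_fst_snd_apply, Fintype.sum_prod_type]
    simp only [h]
    rw [← Finset.sum_mul_sum, ← Finset.mul_sum, ← Finset.sum_mul]
    ring
  have hlog := congrArg Real.log key
  rw [Real.log_mul h0.ne' hd.ne', Real.log_mul hm.ne' hn.ne'] at hlog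
  rw [hlog]
  ring

theorem miW_nonneg {α β W : Type*} [Fintype α] [Fintype β] [Fintype W]
    {q : (α × β) × W → ℝ} (hq : IsPMF q) : 0 ≤ miW q := by
  have h := cmi_nonneg (pmfMap_nonneg (fun x : (α × β) × W => ((x.1, x.2), ())) hq.1)
  simp only [cmi, pmfMap_pmfMap] at h
  have h₁ : Hent (pmfMap (fun _ => ()) q) = 0 := by simp [Hent_pmfMap, pmfMap, hq.2]
  have h₂ := Hent_pmfMap_congr q (fun x => (x.1, ())) Prod.fst (by simp)
  have h₃ := Hent_pmfMap_congr q (fun x => (x.2, ())) Prod.snd (by simp)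
  have h₄ := Hent_pmfMap_congr q (fun x => ((x.1, x.2), ())) (fun x => x) (by simp)
  rw [h₁, h₂, h₃, h₄, pmfMap_id] at h
  rw [miW]
  linarith

theorem relaxedSet_bddBelow {α β : Type*} [Fintype α] [Fintype β] (p : α × β → ℝ) (γ : ℝ) :
    BddBelow (relaxedSet p γ) := by
  refine ⟨0, ?_⟩
  rintro _ ⟨m, q, hq, -, -, rfl⟩
  exact miW_nonneg hq

theorem Cgamma_le_miW {α β : Type*} [Fintype α] [Fintype β] {p : α × β → ℝ} {γ : ℝ} {m : ℕ}
    {q : (α × β) × Fin m → ℝ} (hq : IsPMF q) (hqp : pmfMap Prod.fst q = p) (hc : cmi q ≤ γ) :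
    Cgamma p γ ≤ miW q :=
  csInf_le (relaxedSet_bddBelow p γ) ⟨m, q, hq, hqp, hc, rfl⟩

theorem relaxedSet_nonempty {α β : Type*} [Fintype α] [Fintype β] {p : α × β → ℝ}
    (hp : IsPMF p) {γ : ℝ} (hγ : 0 ≤ γ) : (relaxedSet p γ).Nonempty := by
  let e := Fintype.equivFin (α × β)
  refine ⟨_, _, pmfMap (fun x => (x, e x)) p, hp.pmfMap _, ?_, le_of_eq_of_le ?_ hγ, rfl⟩
  · rw [pmfMap_pmfMap, pmfMap_id]
  · simp only [cmi, pmfMap_pmfMap]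
    rw [Hent_pmfMap_congr p (fun x => (x.1, e x)) (fun x => x) (by simp +contextual),
      Hent_pmfMap_congr p (fun x => (x.2, e x)) (fun x => x) (by simp +contextual),
      Hent_pmfMap_congr p (fun x => e x) (fun x => x) (by simp),
      Hent_pmfMap_congr p (fun x => (x, e x)) (fun x => x) (by simp)]
    ring

theorem relaxedSet_subset_swap {α β : Type*} [Fintype α] [Fintype β] (p : α × β → ℝ) (γ : ℝ) :
    relaxedSet p γ ⊆ relaxedSet (pmfMap Prod.swap p) γ := by
  rintro _ ⟨m, q, hq, rfl, hc, rfl⟩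
  have hswap : Hent (pmfMap (fun x => (x.1.swap, x.2)) q) = Hent q := by
    rw [Hent_pmfMap_congr q _ (fun x => x) (by simp [Prod.ext_iff, and_comm]), pmfMap_id]
  refine ⟨m, pmfMap (fun x => (x.1.swap, x.2)) q, hq.pmfMap _, ?_, ?_, ?_⟩
  · rw [pmfMap_pmfMap, pmfMap_pmfMap]
  · simp only [cmi, pmfMap_pmfMap, Prod.fst_swap, Prod.snd_swap, hswap] at hc ⊢
    linarith
  · simp only [miW, pmfMap_pmfMap, hswap]
    rw [Hent_pmfMap_congr q (fun x => x.1.swap) Prod.fst (by simp)]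

theorem Cgamma_swap {α β : Type*} [Fintype α] [Fintype β] (p : α × β → ℝ) (γ : ℝ) :
    Cgamma (pmfMap Prod.swap p) γ = Cgamma p γ := by
  have h := relaxedSet_subset_swap (pmfMap Prod.swap p) γ
  simp only [pmfMap_pmfMap, Prod.swap_swap, pmfMap_id] at h
  rw [Cgamma, Cgamma, h.antisymm (relaxedSet_subset_swap p γ)]

/-- If `q` is a pmf of `((X,Y),W)` and `k y z` is nonnegative, the joint function
`q((x,y),w) k(y,z)` decreases both information quantities when `Y` is replaced by `Z`. -/
theorem information_le_of_kernel {α β δ W : Type*} [Fintype α] [Fintype β] [Fintype δ]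
    [Fintype W] {q : (α × β) × W → ℝ} (hq : ∀ x, 0 ≤ q x) {k : β → δ → ℝ}
    (hk : ∀ b c, 0 ≤ k b c) (s : α × β × δ × W → ℝ)
    (hs : ∀ x, s x = q ((x.1, x.2.1), x.2.2.2) * k x.2.1 x.2.2.1)
    (hsq : pmfMap (fun x => ((x.1, x.2.1), x.2.2.2)) s = q) :
    cmi (pmfMap (fun x => ((x.1, x.2.2.1), x.2.2.2)) s) ≤ cmi q ∧
      miW (pmfMap (fun x => ((x.1, x.2.2.1), x.2.2.2)) s) ≤ miW q := by
  have hs0 : ∀ x, 0 ≤ s x := fun x => by rw [hs]; exact mul_nonneg (hq _) (hk _ _)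
  have h₁ := cmi_nonneg (pmfMap_nonneg
    (fun x : α × β × δ × W => ((x.1, x.2.1), (x.2.2.1, x.2.2.2))) hs0)
  have h₂ := cmi_nonneg (pmfMap_nonneg
    (fun x : α × β × δ × W => ((x.2.1, x.2.2.2), (x.1, x.2.2.1))) hs0)
  have h₃ : cmi (pmfMap
      (fun x : α × β × δ × W => ((x.1, x.2.2.1), (x.2.1, x.2.2.2))) s) = 0 := by
    refine cmi_eq_zero_of_factor (pmfMap_nonneg _ hs0) (fun a w => q ((a, w.1), w.2))
      (fun c w => k w.1 c) fun a c w => ?_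
    have := pmfMap_apply_of_injective
      (f := fun x : α × β × δ × W => ((x.1, x.2.2.1), (x.2.1, x.2.2.2)))
      (by rintro ⟨_, _, _, _⟩ ⟨_, _, _, _⟩; simp +contextual) s (a, w.1, c, w.2)
    rw [hs] at this
    exact this
  have h₄ : cmi (pmfMap
      (fun x : α × β × δ × W => ((x.2.2.1, x.2.2.2), (x.1, x.2.1))) s) = 0 := by
    refine cmi_eq_zero_of_factor (pmfMap_nonneg _ hs0) (fun c w => k w.2 c)
      (fun d w => q (w, d)) fun c d w => ?_
    have := pmfMap_apply_of_injective
      (f := fun x : α × β × δ × W => ((x.2.2.1, x.2.2.2), (x.1, x.2.1)))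
      (by rintro ⟨_, _, _, _⟩ ⟨_, _, _, _⟩; simp +contextual) s (w.1, w.2, c, d)
    rw [hs, mul_comm] at this
    exact this
  suffices h : cmi (pmfMap (fun x => ((x.1, x.2.2.1), x.2.2.2)) s) ≤
        cmi (pmfMap (fun x => ((x.1, x.2.1), x.2.2.2)) s) ∧
      miW (pmfMap (fun x => ((x.1, x.2.2.1), x.2.2.2)) s) ≤
        miW (pmfMap (fun x => ((x.1, x.2.1), x.2.2.2)) s) by
    rwa [hsq] at h
  simp only [cmi, miW, pmfMap_pmfMap] at h₁ h₂ h₃ h₄ ⊢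
  have xyzw₂ := Hent_pmfMap_congr s (fun x => ((x.2.1, x.2.2.2), (x.1, x.2.2.1)))
    (fun x => ((x.1, x.2.1), (x.2.2.1, x.2.2.2))) (by simp; tauto)
  have xyzw₃ := Hent_pmfMap_congr s (fun x => ((x.1, x.2.2.1), (x.2.1, x.2.2.2)))
    (fun x => ((x.1, x.2.1), (x.2.2.1, x.2.2.2))) (by simp; tauto)
  have xyzw₄ := Hent_pmfMap_congr s (fun x => ((x.2.2.1, x.2.2.2), (x.1, x.2.1)))
    (fun x => ((x.1, x.2.1), (x.2.2.1, x.2.2.2))) (by simp; tauto)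
  have xzw₁ := Hent_pmfMap_congr s (fun x => (x.1, (x.2.2.1, x.2.2.2)))
    (fun x => ((x.1, x.2.2.1), x.2.2.2)) (by simp; tauto)
  have xzw₂ := Hent_pmfMap_congr s (fun x => (x.2.2.2, (x.1, x.2.2.1)))
    (fun x => ((x.1, x.2.2.1), x.2.2.2)) (by simp; tauto)
  have xyw₃ := Hent_pmfMap_congr s (fun x => (x.1, (x.2.1, x.2.2.2)))
    (fun x => ((x.1, x.2.1), x.2.2.2)) (by simp; tauto)
  have xyw₄ := Hent_pmfMap_congr s (fun x => (x.2.2.2, (x.1, x.2.1)))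
    (fun x => ((x.1, x.2.1), x.2.2.2)) (by simp; tauto)
  have yzw := Hent_pmfMap_congr s (fun x => (x.2.2.1, (x.2.1, x.2.2.2)))
    (fun x => (x.2.1, (x.2.2.1, x.2.2.2))) (by simp; tauto)
  have xyz := Hent_pmfMap_congr s (fun x => (x.2.2.1, (x.1, x.2.1)))
    (fun x => (x.2.1, (x.1, x.2.2.1))) (by simp; tauto)
  constructor <;> linarith

theorem pmfMap_left_apply {α β δ : Type*} [Fintype α] [Fintype β] [Fintype δ]
    (r : α × β × δ → ℝ) (a : α) (b : β) :
    pmfMap (fun x => (x.1, x.2.1)) r (a, b) = ∑ c, r (a, b, c) := by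
  simp [pmfMap, Fintype.sum_prod_type, ite_and, sum_ite_zero_of_decidable]

theorem pmfMap_outer_apply {α β δ : Type*} [Fintype α] [Fintype β] [Fintype δ]
    (r : α × β × δ → ℝ) (a : α) (c : δ) :
    pmfMap (fun x => (x.1, x.2.2)) r (a, c) = ∑ b, r (a, b, c) := by
  simp [pmfMap, Fintype.sum_prod_type, ite_and]

theorem pmfMap_drop_third_apply {α β δ W : Type*} [Fintype α] [Fintype β] [Fintype δ]
    [Fintype W] (s : α × β × δ × W → ℝ) (a : α) (b : β) (w : W) :
    pmfMap (fun x => ((x.1, x.2.1), x.2.2.2)) s ((a, b), w) = ∑ c, s (a, b, c, w) := by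
  simp [pmfMap, Fintype.sum_prod_type, ite_and]

theorem pmfMap_first_third_apply {α β δ W : Type*} [Fintype α] [Fintype β] [Fintype δ]
    [Fintype W] (s : α × β × δ × W → ℝ) (a : α) (c : δ) :
    pmfMap (fun x => (x.1, x.2.2.1)) s (a, c) = ∑ b, ∑ w, s (a, b, c, w) := by
  simp [pmfMap, Fintype.sum_prod_type, ite_and, sum_ite_zero_of_decidable]

theorem Cgamma_le_of_markov
    {α β δ : Type*} [Fintype α] [Fintype β] [Fintype δ]
    (r : α × β × δ → ℝ) (hr : IsPMF r)
    (hMarkov : ∀ a b c,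
      r (a, b, c) * (∑ a', ∑ c', r (a', b, c')) =
        (∑ c', r (a, b, c')) * (∑ a', r (a', b, c)))
    (γ : ℝ) (hγ : 0 ≤ γ) :
    Cgamma (pmfMap (fun x => (x.1, x.2.2)) r) γ ≤
      Cgamma (pmfMap (fun x => (x.1, x.2.1)) r) γ := by
  refine le_csInf (relaxedSet_nonempty (hr.pmfMap _) hγ) ?_
  rintro _ ⟨m, q, hq, hqr, hc, rfl⟩
  have hXY : ∀ a b, ∑ w, q ((a, b), w) = ∑ c, r (a, b, c) := fun a b => by
    rw [← pmfMap_fst_apply, hqr, pmfMap_left_apply]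
  let k : β → δ → ℝ := fun b c => (∑ a', r (a', b, c)) / ∑ a', ∑ c', r (a', b, c')
  have hk : ∀ b c, 0 ≤ k b c := fun b c =>
    div_nonneg (Finset.sum_nonneg fun _ _ => hr.1 _)
      (Finset.sum_nonneg fun _ _ => Finset.sum_nonneg fun _ _ => hr.1 _)
  have hY0 : ∀ b, ∑ a', ∑ c', r (a', b, c') = 0 → ∀ a c, r (a, b, c) = 0 := fun b h a c => by
    rw [Finset.sum_eq_zero_iff_of_nonneg
      fun _ _ => Finset.sum_nonneg fun _ _ => hr.1 _] at h
    exact (Finset.sum_eq_zero_iff_of_nonneg fun _ _ => hr.1 _).1 (h a (Finset.mem_univ a)) c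
      (Finset.mem_univ c)
  obtain ⟨s, hs⟩ : ∃ s : α × β × δ × Fin m → ℝ,
      ∀ x, s x = q ((x.1, x.2.1), x.2.2.2) * k x.2.1 x.2.2.1 := ⟨_, fun _ => rfl⟩
  have hsq : pmfMap (fun x => ((x.1, x.2.1), x.2.2.2)) s = q := by
    funext ⟨⟨a, b⟩, w⟩
    rw [pmfMap_drop_third_apply]
    simp only [hs]
    rw [← Finset.mul_sum]
    by_cases h : ∑ a', ∑ c', r (a', b, c') = 0
    · have h1 : ∑ w, q ((a, b), w) = 0 := by
        rw [hXY]; exact Finset.sum_eq_zero fun c _ => hY0 b h a c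
      rw [(Finset.sum_eq_zero_iff_of_nonneg fun _ _ => hq.1 _).1 h1 w (Finset.mem_univ w),
        zero_mul]
    · have : ∑ c, k b c = 1 := by
        rw [← Finset.sum_div, Finset.sum_comm, div_self h]
      rw [this, mul_one]
  have hsr : pmfMap (fun x => (x.1, x.2.2.1)) s = pmfMap (fun x => (x.1, x.2.2)) r := by
    funext ⟨a, c⟩
    rw [pmfMap_first_third_apply, pmfMap_outer_apply]
    refine Finset.sum_congr rfl fun b _ => ?_
    simp only [hs]
    rw [← Finset.sum_mul, hXY]
    by_cases h : ∑ a', ∑ c', r (a', b, c') = 0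
    · simp [k, h, hY0 b h a c]
    · rw [← mul_div_assoc, ← hMarkov, mul_div_cancel_right₀ _ h]
  have hspmf : IsPMF s :=
    ⟨fun x => by rw [hs]; exact mul_nonneg (hq.1 _) (hk _ _), by
      rw [← sum_pmfMap (fun x => ((x.1, x.2.1), x.2.2.2)) s, hsq, hq.2]⟩
  obtain ⟨hcmi, hmi⟩ := information_le_of_kernel hq.1 hk s hs hsq
  exact (Cgamma_le_miW (hspmf.pmfMap _) (by rw [pmfMap_pmfMap, hsr]) (hcmi.trans hc)).trans hmi

/-- **Data processing inequality.** If `X — Y — Z` form a Markov chain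
(`X` and `Z` conditionally independent given `Y`, i.e. `p(x,y,z)·p(y) = p(x,y)·p(y,z)`),
then for every `γ ≥ 0`, `C_γ(X;Z) ≤ min{C_γ(X;Y), C_γ(Y;Z)}`. -/
theorem relaxedWyner_data_processing
    {α β δ : Type*} [Fintype α] [Fintype β] [Fintype δ]
    (r : α × β × δ → ℝ) (hr : IsPMF r)
    (hMarkov : ∀ a b c,
      r (a, b, c) * (∑ a', ∑ c', r (a', b, c')) =
        (∑ c', r (a, b, c')) * (∑ a', r (a', b, c)))
    (γ : ℝ) (hγ : 0 ≤ γ) :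
    Cgamma (pmfMap (fun x => (x.1, x.2.2)) r) γ ≤
      min (Cgamma (pmfMap (fun x => (x.1, x.2.1)) r) γ)
          (Cgamma (pmfMap (fun x => (x.2.1, x.2.2)) r) γ) := by
  refine le_min (Cgamma_le_of_markov r hr hMarkov γ hγ) ?_
  let f : α × β × δ → δ × β × α := fun x => (x.2.2, x.2.1, x.1)
  have hf : ∀ a b c, pmfMap f r (c, b, a) = r (a, b, c) := fun a b c =>
    pmfMap_apply_of_injective (f := f)
      (by rintro ⟨_, _, _⟩ ⟨_, _, _⟩; simp +contextual [f]) r (a, b, c)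
  have h := Cgamma_le_of_markov (pmfMap f r) (hr.pmfMap f) (fun c b a => by
    simp only [hf]
    rw [Finset.sum_comm, hMarkov, mul_comm]) γ hγ
  rw [← Cgamma_swap, ← Cgamma_swap (pmfMap (fun x => (x.1, x.2.1)) (pmfMap f r))] at h
  simpa only [pmfMap_pmfMap, f, Prod.swap_prod_mk] using h
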